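/- For every permutation π of {1,…,n+1} and every probability density function f : ℝ → ℝ, the integral of ∏_{i=1}^n f(x_i) over D_π equals the integral of ∏_{i=1}^n f((L_π x)_i) over the open positive orthant (0,∞)^n, where (L_π x)_i denotes the i-th coordinate of L_π x. In particular P(f,π) = ∫_{(0,∞)^n} ∏_{i=1}^n f((L_π x)_i) dx. -/

import Mathlib

open MeasureTheory

noncomputable section

/-- Walk positions: `walk n x i = x 0 + ⋯ + x (i-1)` (so `walk n x 0 = 0`). -/
def walk (n : ℕ) (x : Fin n → ℝ) (i : Fin (n + 1)) : ℝ :=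
  ∑ j : Fin n, if (j : ℕ) < (i : ℕ) then x j else 0

/-- The region of step tuples generating the ordinal pattern `π`. -/
def D (n : ℕ) (π : Equiv.Perm (Fin (n + 1))) : Set (Fin n → ℝ) :=
  {x | (∀ i j : Fin (n + 1), i ≠ j → walk n x i ≠ walk n x j) ∧
       (∀ i j : Fin (n + 1), walk n x i < walk n x j ↔ π i < π j)}

/-- The matrix `L_π`. -/
def L (n : ℕ) (π : Equiv.Perm (Fin (n + 1))) : Matrix (Fin n) (Fin n) ℝ :=
  fun i j =>
    if (π i.castSucc : ℕ) ≤ (j : ℕ) ∧ (j : ℕ) < (π i.succ : ℕ) then 1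
    else if (π i.succ : ℕ) ≤ (j : ℕ) ∧ (j : ℕ) < (π i.castSucc : ℕ) then -1
    else 0

/-- Partial sum `x i + x (i+1) + ⋯ + x (j-1)`. -/
def psum (n : ℕ) (x : Fin n → ℝ) (i j : Fin (n + 1)) : ℝ :=
  ∑ k : Fin n, if (i : ℕ) ≤ (k : ℕ) ∧ (k : ℕ) < (j : ℕ) then x k else 0

/-- The level count `lev(π)_j`. -/
def lev (n : ℕ) (π : Equiv.Perm (Fin (n + 1))) (j : Fin n) : ℕ :=
  (Finset.univ.filter fun i : Fin n =>
    ((π i.castSucc : ℕ) ≤ (j : ℕ) ∧ (j : ℕ) < (π i.succ : ℕ)) ∨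
    ((π i.succ : ℕ) ≤ (j : ℕ) ∧ (j : ℕ) < (π i.castSucc : ℕ))).card

/-- The polytope of steps `P_π`. -/
def Ppoly (n : ℕ) (π : Equiv.Perm (Fin (n + 1))) : Set (Fin n → ℝ) :=
  {x | (∀ i, 0 ≤ x i) ∧ ∀ i : Fin n,
    psum n x (min (π i.castSucc) (π i.succ)) (max (π i.castSucc) (π i.succ)) ≤ 1}

/-- The set of positive roots, identified with pairs `i < j`. -/
def PosRoot (n : ℕ) := {p : Fin (n + 1) × Fin (n + 1) // p.1 < p.2}

/-- The Shi condition for an alcove address. -/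
def Shi (n : ℕ) (k : PosRoot n → ℤ) : Prop :=
  ∀ (i t j : Fin (n + 1)) (hit : i < t) (htj : t < j),
    k ⟨(i, t), hit⟩ + k ⟨(t, j), htj⟩ ≤ k ⟨(i, j), hit.trans htj⟩ ∧
    k ⟨(i, j), hit.trans htj⟩ ≤ k ⟨(i, t), hit⟩ + k ⟨(t, j), htj⟩ + 1

/-- The alcove with address `k`, in step coordinates. -/
def alcove (n : ℕ) (k : PosRoot n → ℤ) : Set (Fin n → ℝ) :=
  {x | ∀ p : PosRoot n,
    (k p : ℝ) < psum n x p.1.1 p.1.2 ∧ psum n x p.1.1 p.1.2 < (k p : ℝ) + 1}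

/-- The root ideal `I_π`. -/
def rootIdeal (n : ℕ) (π : Equiv.Perm (Fin (n + 1))) : Set (PosRoot n) :=
  {p | ∃ c : Fin n,
    min (π c.castSucc : ℕ) (π c.succ : ℕ) ≤ (p.1.1 : ℕ) ∧
    (p.1.2 : ℕ) ≤ max (π c.castSucc : ℕ) (π c.succ : ℕ)}

/-- The level count matrix `lev(π)_{i,j}`. -/
def lev2 (n : ℕ) (π : Equiv.Perm (Fin (n + 1))) (i j : Fin n) : ℕ :=
  (Finset.univ.filter fun k : Fin n =>
    ((π k.castSucc : ℕ) ≤ (i : ℕ) ∧ (π k.castSucc : ℕ) ≤ (j : ℕ) ∧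
     (i : ℕ) < (π k.succ : ℕ) ∧ (j : ℕ) < (π k.succ : ℕ)) ∨
    ((π k.succ : ℕ) ≤ (i : ℕ) ∧ (π k.succ : ℕ) ≤ (j : ℕ) ∧
     (i : ℕ) < (π k.castSucc : ℕ) ∧ (j : ℕ) < (π k.castSucc : ℕ))).card

theorem walk_zero (n : ℕ) (x : Fin n → ℝ) : walk n x 0 = 0 := by
  simp [walk]

theorem walk_succ_sub_walk_castSucc (n : ℕ) (x : Fin n → ℝ) (i : Fin n) :
    walk n x i.succ - walk n x i.castSucc = x i := by
  unfold walk
  rw [← Finset.sum_sub_distrib, Finset.sum_eq_single i]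
  · simp
  · intro j _ hji
    have : (j : ℕ) ≠ i := fun h => hji (Fin.ext h)
    have : (j : ℕ) < i + 1 ↔ (j : ℕ) < i := by omega
    simp [this]
  · simp

/-- The walk is the only function starting at `0` with the given increments. -/
theorem walk_eq_sub (n : ℕ) (x : Fin n → ℝ) (g : Fin (n + 1) → ℝ)
    (hg : ∀ i : Fin n, x i = g i.succ - g i.castSucc) (i : Fin (n + 1)) :
    walk n x i = g i - g 0 := by
  induction i using Fin.induction with
  | zero => simp [walk_zero]
  | succ i ih => linarith [hg i, walk_succ_sub_walk_castSucc n x i]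

theorem L_mulVec (n : ℕ) (π : Equiv.Perm (Fin (n + 1))) (y : Fin n → ℝ) (i : Fin n) :
    (L n π).mulVec y i = walk n y (π i.succ) - walk n y (π i.castSucc) := by
  unfold walk Matrix.mulVec dotProduct L
  rw [← Finset.sum_sub_distrib]
  refine Finset.sum_congr rfl fun j _ => ?_
  grind

theorem walk_L_mulVec (n : ℕ) (π : Equiv.Perm (Fin (n + 1))) (y : Fin n → ℝ)
    (i : Fin (n + 1)) :
    walk n ((L n π).mulVec y) i = walk n y (π i) - walk n y (π 0) :=
  walk_eq_sub n _ (fun i => walk n y (π i)) (L_mulVec n π y) i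

theorem L_symm_mulVec_L_mulVec (n : ℕ) (π : Equiv.Perm (Fin (n + 1))) (y : Fin n → ℝ) :
    (L n π.symm).mulVec ((L n π).mulVec y) = y := by
  ext k
  simp [L_mulVec n π.symm, walk_L_mulVec, walk_succ_sub_walk_castSucc]

theorem L_symm_mul_L (n : ℕ) (π : Equiv.Perm (Fin (n + 1))) : L n π.symm * L n π = 1 := by
  refine Matrix.ext_of_mulVec_single fun i => ?_
  rw [← Matrix.mulVec_mulVec, L_symm_mulVec_L_mulVec, Matrix.one_mulVec]

theorem exists_intCast_eq_det_L (n : ℕ) (π : Equiv.Perm (Fin (n + 1))) :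
    ∃ d : ℤ, (d : ℝ) = (L n π).det := by
  let M : Matrix (Fin n) (Fin n) ℤ := .of fun i j =>
    if (π i.castSucc : ℕ) ≤ (j : ℕ) ∧ (j : ℕ) < (π i.succ : ℕ) then 1
    else if (π i.succ : ℕ) ≤ (j : ℕ) ∧ (j : ℕ) < (π i.castSucc : ℕ) then -1
    else 0
  refine ⟨M.det, ?_⟩
  rw [Int.cast_det]
  congr 1
  ext i j
  simp only [M, L, Matrix.map_apply, Matrix.of_apply]
  split_ifs <;> simp

theorem abs_det_L (n : ℕ) (π : Equiv.Perm (Fin (n + 1))) : |(L n π).det| = 1 := by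
  obtain ⟨d, hd⟩ := exists_intCast_eq_det_L n π
  obtain ⟨e, he⟩ := exists_intCast_eq_det_L n π.symm
  have h : (e : ℝ) * d = 1 := by
    rw [hd, he, ← Matrix.det_mul, L_symm_mul_L, Matrix.det_one]
  have hunit : IsUnit d := .of_mul_eq_one_right e (by exact_mod_cast h)
  rw [← hd]
  exact_mod_cast Int.isUnit_iff_abs_eq.mp hunit

theorem mem_D_iff_strictMono (n : ℕ) (π : Equiv.Perm (Fin (n + 1))) (x : Fin n → ℝ) :
    x ∈ D n π ↔ StrictMono fun k => walk n x (π.symm k) := by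
  constructor
  · intro h i j hij
    exact (h.2 _ _).2 (by simpa using hij)
  · intro h
    have hlt (i j : Fin (n + 1)) : walk n x i < walk n x j ↔ π i < π j := by
      simpa using h.lt_iff_lt (a := π i) (b := π j)
    refine ⟨fun i j hij heq => hij (π.injective (h.injective ?_)), hlt⟩
    simpa using heq

theorem mem_D_iff_L_symm_mulVec_pos (n : ℕ) (π : Equiv.Perm (Fin (n + 1))) (x : Fin n → ℝ) :
    x ∈ D n π ↔ ∀ i, 0 < (L n π.symm).mulVec x i := by
  simp [mem_D_iff_strictMono, Fin.strictMono_iff_lt_succ, L_mulVec]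

theorem L_mulVec_image_orthant (n : ℕ) (π : Equiv.Perm (Fin (n + 1))) :
    (L n π).mulVec '' {x | ∀ i, 0 < x i} = D n π := by
  ext x
  rw [mem_D_iff_L_symm_mulVec_pos]
  constructor
  · rintro ⟨y, hy, rfl⟩
    rwa [L_symm_mulVec_L_mulVec]
  · intro hx
    exact ⟨_, hx, L_symm_mulVec_L_mulVec n π.symm x⟩

/-- change of variables formula for `P(f,π)`. -/
theorem stmt_4 (n : ℕ) (hn : 1 ≤ n) (π : Equiv.Perm (Fin (n + 1))) (f : ℝ → ℝ)
    (hmeas : Measurable f) (hpos : ∀ x, 0 ≤ f x) (hint : ∫ x, f x = 1) :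
    ∫ x in D n π, ∏ i : Fin n, f (x i) =
    ∫ x in {x : Fin n → ℝ | ∀ i, 0 < x i}, ∏ i : Fin n, f ((L n π).mulVec x i) := by
  have hmeas_orthant : MeasurableSet {x : Fin n → ℝ | ∀ i, 0 < x i} := by
    measurability
  have hderiv (x : Fin n → ℝ) (_ : x ∈ {x : Fin n → ℝ | ∀ i, 0 < x i}) :
      HasFDerivWithinAt (L n π).mulVec (Matrix.toLin' (L n π)).toContinuousLinearMap
        {x | ∀ i, 0 < x i} x :=
    (Matrix.toLin' (L n π)).toContinuousLinearMap.hasFDerivWithinAt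
  rw [← L_mulVec_image_orthant, integral_image_eq_integral_abs_det_fderiv_smul volume
    hmeas_orthant hderiv
    (Function.LeftInverse.injective (L_symm_mulVec_L_mulVec n π)).injOn]
  simp [LinearMap.det_toContinuousLinearMap, LinearMap.det_toLin', abs_det_L]
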